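/- Let q₁ and q₂ be two real-valued integrable potentials on ℝ vanishing outside [0,1], with Jost functions ψ₁ and ψ₂ respectively. Let (r_n)_{n≥1} be a sequence of positive real numbers with |r_n − πn/2| < π/8 for every n ≥ 1. If ψ₁(−r_n)·ψ₂(r_n) = ψ₂(−r_n)·ψ₁(r_n) for all n ≥ 1 (i.e., the S-matrices S_j(k) = ψ_j(−k)/ψ_j(k) of the two potentials agree at every point r_n), then q₁ = q₂ almost everywhere. -/

import Mathlib

open MeasureTheory Set

noncomputable section

/-- `y` solves `-y'' + q y = E y` on `[0,∞)`: `y` is continuously differentiable with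
derivative `y'`, `y'` is absolutely continuous (an indefinite integral of a locally
integrable `y''`), and the equation holds for a.e. `x ≥ 0`. -/
def SchrodingerSol (q : ℝ → ℂ) (E : ℂ) (y y' : ℝ → ℂ) : Prop :=
  (∀ x : ℝ, 0 ≤ x → HasDerivAt y (y' x) x) ∧
  ∃ y'' : ℝ → ℂ,
    (∀ X : ℝ, IntegrableOn y'' (Icc 0 X)) ∧
    (∀ x : ℝ, 0 ≤ x → y' x = y' 0 + ∫ t in (0:ℝ)..x, y'' t) ∧
    (∀ᵐ x : ℝ, 0 ≤ x → -y'' x + q x * y x = E * y x)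

/-- The Jost solution `f₊(·,k)` (with derivative `f'`): it solves
`-y'' + q y = k² y` and equals `e^{ikx}` for `x ≥ 1`. -/
def IsJost (q : ℝ → ℂ) (k : ℂ) (f f' : ℝ → ℂ) : Prop :=
  SchrodingerSol q (k ^ 2) f f' ∧
  ∀ x : ℝ, 1 ≤ x → f x = Complex.exp (Complex.I * k * (x : ℂ))

/-- The fundamental solution `φ(·,k)` (with derivative `y'`): it solves
`-y'' + q y = k² y` with `y(0) = 0`, `y'(0) = 1`. -/
def IsPhi (q : ℝ → ℂ) (k : ℂ) (y y' : ℝ → ℂ) : Prop :=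
  SchrodingerSol q (k ^ 2) y y' ∧ y 0 = 0 ∧ y' 0 = 1

/-- `A` is on `[0,1]` an indefinite integral of the integrable function `α`. -/
def IsPrim {𝕜 : Type*} [RCLike 𝕜] (A α : ℝ → 𝕜) : Prop :=
  IntervalIntegrable α volume 0 1 ∧ ∀ x ∈ Icc (0:ℝ) 1, A x = A 0 + ∫ t in (0:ℝ)..x, α t

section Prim

variable {𝕜 : Type*} [RCLike 𝕜] {A B α β : ℝ → 𝕜}

lemma intervalIntegrable_sub_unit {α : ℝ → 𝕜} (h : IntervalIntegrable α volume 0 1) {x y : ℝ}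
    (hx : x ∈ Icc (0:ℝ) 1) (hy : y ∈ Icc (0:ℝ) 1) : IntervalIntegrable α volume x y := by
  apply h.mono_set
  rw [uIcc_of_le (zero_le_one' ℝ)]
  exact uIcc_subset_Icc hx hy

lemma absolutelyContinuous_integral (h : IntervalIntegrable α volume 0 1) :
    AbsolutelyContinuousOnInterval (fun x => ∫ t in (0:ℝ)..x, α t) 0 1 := by
  have hc : ∀ c : 𝕜, AbsolutelyContinuousOnInterval (fun _ : ℝ => c) 0 1 := fun c =>
    (LipschitzWith.const c).lipschitzOnWith.absolutelyContinuousOnInterval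
  have hre : IntervalIntegrable (fun t => RCLike.re (α t)) volume 0 1 := ⟨h.1.re, h.2.re⟩
  have him : IntervalIntegrable (fun t => RCLike.im (α t)) volume 0 1 := ⟨h.1.im, h.2.im⟩
  have h1 := (hre.absolutelyContinuousOnInterval_intervalIntegral (c := 0) (by simp)).smul
    (hc (1 : 𝕜))
  have h2 := (him.absolutelyContinuousOnInterval_intervalIntegral (c := 0) (by simp)).smul
    (hc (RCLike.I : 𝕜))
  have h3 := h1.add h2
  refine Filter.Tendsto.congr' ?_ h3
  filter_upwards [Filter.mem_inf_of_right (Filter.mem_principal_self _)] with E hE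
  refine Finset.sum_congr rfl fun i hi => ?_
  have key : ∀ x ∈ Icc (0:ℝ) 1, (∫ t in (0:ℝ)..x, RCLike.re (α t)) • (1:𝕜)
      + (∫ t in (0:ℝ)..x, RCLike.im (α t)) • (RCLike.I:𝕜) = ∫ t in (0:ℝ)..x, α t := by
    intro x hx
    have hi := intervalIntegrable_sub_unit h (left_mem_Icc.2 zero_le_one) hx
    rw [intervalIntegral.integral_of_le hx.1, intervalIntegral.integral_of_le hx.1,
      intervalIntegral.integral_of_le hx.1]
    have := integral_re_add_im (𝕜 := 𝕜) hi.1
    rw [← this]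
    simp [RCLike.real_smul_eq_coe_mul]
  have hmem := hE.1 i hi
  rw [uIcc_of_le (zero_le_one' ℝ)] at hmem
  rw [← key _ hmem.1, ← key _ hmem.2]
  rfl

lemma IsPrim.absolutelyContinuous (h : IsPrim A α) : AbsolutelyContinuousOnInterval A 0 1 := by
  have h1 := (LipschitzWith.const (A 0)).lipschitzOnWith.absolutelyContinuousOnInterval.add
    (absolutelyContinuous_integral h.1)
  refine Filter.Tendsto.congr' ?_ h1
  filter_upwards [Filter.mem_inf_of_right (Filter.mem_principal_self _)] with E hE
  refine Finset.sum_congr rfl fun i hi => ?_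
  have hmem := hE.1 i hi
  rw [uIcc_of_le (zero_le_one' ℝ)] at hmem
  rw [h.2 _ hmem.1, h.2 _ hmem.2]
  rfl

lemma IsPrim.continuousOn (h : IsPrim A α) : ContinuousOn A (Icc 0 1) := by
  have := h.absolutelyContinuous.continuousOn
  rwa [uIcc_of_le (zero_le_one' ℝ)] at this

lemma IsPrim.ae_hasDerivAt (h : IsPrim A α) :
    ∀ᵐ x, x ∈ Icc (0:ℝ) 1 → HasDerivAt A (α x) x := by
  have h0 : ∀ᵐ x : ℝ, x ≠ 0 := by simp [ae_iff]
  have h1 : ∀ᵐ x : ℝ, x ≠ 1 := by simp [ae_iff]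
  filter_upwards [h.1.ae_hasDerivAt_integral, h0, h1] with x hx hx0 hx1 hmem
  have hm : x ∈ uIcc (0:ℝ) 1 := by rwa [uIcc_of_le (zero_le_one' ℝ)]
  have hd := (hx hm 0 (by simp)).const_add (A 0)
  refine hd.congr_of_eventuallyEq ?_
  have : Ioo (0:ℝ) 1 ∈ nhds x := Ioo_mem_nhds (lt_of_le_of_ne hmem.1 hx0.symm)
    (lt_of_le_of_ne hmem.2 hx1)
  filter_upwards [this] with y hy
  exact h.2 y ⟨hy.1.le, hy.2.le⟩

lemma isPrim_of_ae (hA : AbsolutelyContinuousOnInterval A 0 1)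
    (hα : IntervalIntegrable α volume 0 1)
    (hd : ∀ᵐ x, x ∈ Icc (0:ℝ) 1 → HasDerivAt A (α x) x) : IsPrim A α := by
  refine ⟨hα, fun x hx => ?_⟩
  have hI : IsPrim (fun x => ∫ t in (0:ℝ)..x, α t) α := ⟨hα, by simp⟩
  obtain ⟨C, hC⟩ := (hA.sub (absolutelyContinuous_integral hα)).const_of_ae_hasDerivAt_zero (by
    rw [uIcc_of_le (zero_le_one' ℝ)]
    filter_upwards [hd, hI.ae_hasDerivAt] with x h1 h2 hx
    simpa using (h1 hx).sub (h2 hx))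
  rw [uIcc_of_le (zero_le_one' ℝ)] at hC
  have e0 := hC 0 (by simp)
  have e1 := hC x hx
  simp only [Pi.sub_apply, intervalIntegral.integral_same, sub_zero] at e0 e1
  rw [e0, ← e1]; ring

lemma IsPrim.intervalIntegrable_mul (hA : ContinuousOn A (Icc 0 1))
    (hβ : IntervalIntegrable β volume 0 1) :
    IntervalIntegrable (fun x => A x * β x) volume 0 1 := by
  apply hβ.continuousOn_mul
  rwa [uIcc_of_le (zero_le_one' ℝ)]

lemma IsPrim.mul (hA : IsPrim A α) (hB : IsPrim B β) :
    IsPrim (fun x => A x * B x) (fun x => α x * B x + A x * β x) := by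
  refine isPrim_of_ae (hA.absolutelyContinuous.smul hB.absolutelyContinuous) ?_ ?_
  · refine IntervalIntegrable.add ?_ (IsPrim.intervalIntegrable_mul hA.continuousOn hB.1)
    simpa only [mul_comm] using IsPrim.intervalIntegrable_mul hB.continuousOn hA.1
  · filter_upwards [hA.ae_hasDerivAt, hB.ae_hasDerivAt] with x h1 h2 hx
    exact (h1 hx).mul (h2 hx)

lemma IsPrim.add (hA : IsPrim A α) (hB : IsPrim B β) :
    IsPrim (fun x => A x + B x) (fun x => α x + β x) := by
  refine isPrim_of_ae (hA.absolutelyContinuous.add hB.absolutelyContinuous) (hA.1.add hB.1) ?_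
  filter_upwards [hA.ae_hasDerivAt, hB.ae_hasDerivAt] with x h1 h2 hx
  exact (h1 hx).add (h2 hx)

lemma IsPrim.const_mul (c : 𝕜) (hA : IsPrim A α) :
    IsPrim (fun x => c * A x) (fun x => c * α x) := by
  refine ⟨hA.1.const_mul c, fun x hx => ?_⟩
  beta_reduce
  rw [hA.2 x hx, intervalIntegral.integral_const_mul]; ring

lemma IsPrim.sub (hA : IsPrim A α) (hB : IsPrim B β) :
    IsPrim (fun x => A x - B x) (fun x => α x - β x) := by
  have := hA.add (hB.const_mul (-1))
  simpa [sub_eq_add_neg] using this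

lemma IsPrim.pow (hA : IsPrim A α) (n : ℕ) :
    IsPrim (fun x => A x ^ (n + 1)) (fun x => (n + 1) * (α x * A x ^ n)) := by
  induction n with
  | zero => simpa using hA
  | succ n ih =>
    have := ih.mul hA
    convert this using 2 with x x <;> (push_cast; ring)

lemma IsPrim.congr (hA : IsPrim A α) (h : ∀ᵐ x, x ∈ Icc (0:ℝ) 1 → α x = β x) : IsPrim A β := by
  have h' : ∀ᵐ x, x ∈ uIoc (0:ℝ) 1 → α x = β x := by
    filter_upwards [h] with x hx hm
    rw [uIoc_of_le (zero_le_one' ℝ)] at hm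
    exact hx ⟨hm.1.le, hm.2⟩
  refine ⟨(intervalIntegrable_congr_ae ((ae_restrict_iff' measurableSet_uIoc).2 h')).1 hA.1,
    fun x hx => ?_⟩
  rw [hA.2 x hx]
  congr 1
  apply intervalIntegral.integral_congr_ae
  filter_upwards [h] with t ht hm
  rw [uIoc_of_le hx.1] at hm
  exact ht ⟨hm.1.le, hm.2.trans hx.2⟩

lemma IsPrim.sub_eq (hA : IsPrim A α) {x y : ℝ} (hx : x ∈ Icc (0:ℝ) 1) (hy : y ∈ Icc (0:ℝ) 1) :
    A y - A x = ∫ t in x..y, α t := by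
  have h0 : (0:ℝ) ∈ Icc (0:ℝ) 1 := by simp
  rw [hA.2 x hx, hA.2 y hy, ← intervalIntegral.integral_add_adjacent_intervals
    (intervalIntegrable_sub_unit hA.1 h0 hx) (intervalIntegrable_sub_unit hA.1 hx hy)]
  ring

lemma isPrim_of_hasDerivAt (h : ∀ x ∈ Icc (0:ℝ) 1, HasDerivAt A (α x) x)
    (hα : ContinuousOn α (Icc 0 1)) : IsPrim A α := by
  have hi : IntervalIntegrable α volume 0 1 := by
    apply ContinuousOn.intervalIntegrable
    rwa [uIcc_of_le (zero_le_one' ℝ)]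
  refine ⟨hi, fun x hx => ?_⟩
  have h0 : (0:ℝ) ∈ Icc (0:ℝ) 1 := by simp
  rw [intervalIntegral.integral_eq_sub_of_hasDerivAt (f := A)
    (fun t ht => h t (uIcc_subset_Icc h0 hx ht)) (intervalIntegrable_sub_unit hi h0 hx)]
  ring

end Prim

section Gronwall

/-- Backward Grönwall inequality with an integrable weight. -/
lemma exists_gronwall_backward {p : ℝ → ℝ} (hp : IntervalIntegrable p volume 0 1)
    (hp0 : ∀ x, 0 ≤ p x) :
    ∃ C : ℝ, 0 ≤ C ∧ ∀ (h : ℝ → ℝ) (A : ℝ), 0 ≤ A → ContinuousOn h (Icc 0 1) →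
      (∀ x ∈ Icc (0:ℝ) 1, 0 ≤ h x) →
      (∀ x ∈ Icc (0:ℝ) 1, h x ≤ A + ∫ t in x..1, p t * h t) →
      ∀ x ∈ Icc (0:ℝ) 1, h x ≤ C * A := by
  have h1m : (1:ℝ) ∈ Icc (0:ℝ) 1 := by simp
  set N : ℝ := ∫ t in (0:ℝ)..1, p t with hN
  set ω : ℝ → ℝ := fun x => 1 + N - ∫ t in (0:ℝ)..x, p t with hω
  have hωp : IsPrim ω (fun x => - p x) := by
    refine ⟨hp.neg, fun x _ => ?_⟩
    simp [hω]; ring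
  have hω' : ∀ x ∈ Icc (0:ℝ) 1, ω x = 1 + ∫ t in x..1, p t := by
    intro x hx
    have := intervalIntegral.integral_add_adjacent_intervals
      (intervalIntegrable_sub_unit hp (left_mem_Icc.2 zero_le_one) hx)
      (intervalIntegrable_sub_unit hp hx h1m)
    simp only [hω]; linarith
  have hω1 : ∀ x ∈ Icc (0:ℝ) 1, 1 ≤ ω x := by
    intro x hx
    rw [hω' x hx]
    linarith [intervalIntegral.integral_nonneg (μ := volume) hx.2 (fun t _ => hp0 t)]
  have hωN : ∀ x ∈ Icc (0:ℝ) 1, ω x ≤ 1 + N := by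
    intro x hx
    have := intervalIntegral.integral_nonneg (μ := volume) hx.1 (fun t _ => hp0 t)
    simp only [hω]; linarith
  have hN0 : 0 ≤ N := by linarith [hω1 1 h1m, hωN 1 h1m]
  obtain ⟨n, hn⟩ := exists_nat_ge (2 * (1 + N))
  have hpow := hωp.pow n
  have hint : ∀ x ∈ Icc (0:ℝ) 1, ∫ t in x..1, p t * ω t ^ n ≤ ω x ^ n / 2 := by
    intro x hx
    have e := hpow.sub_eq hx h1m
    have e1 : ω 1 = 1 := by rw [hω' 1 h1m]; simp
    rw [intervalIntegral.integral_const_mul] at e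
    simp only [neg_mul, intervalIntegral.integral_neg, e1, one_pow] at e
    have h2 : ω x ^ (n + 1) ≤ ω x ^ n * (1 + N) := by
      rw [pow_succ]
      exact mul_le_mul_of_nonneg_left (hωN x hx) (pow_nonneg (by linarith [hω1 x hx]) _)
    have hpos : 0 ≤ ω x ^ n := pow_nonneg (by linarith [hω1 x hx]) _
    have hn1 : (0:ℝ) < n + 1 := by positivity
    set J := ∫ t in x..1, p t * ω t ^ n
    have h3 : (n + 1 : ℝ) * J ≤ (n + 1) * (ω x ^ n / 2) := by nlinarith
    exact le_of_mul_le_mul_left h3 hn1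
  have hωc := hωp.continuousOn
  refine ⟨2 * (1 + N) ^ n, by positivity, fun h A hA hc h0 hle => ?_⟩
  have hrc : ContinuousOn (fun x => h x / ω x ^ n) (Icc 0 1) :=
    hc.div (hωc.pow n) fun x hx => by have := hω1 x hx; positivity
  obtain ⟨z, hz, hmax⟩ := isCompact_Icc.exists_isMaxOn (nonempty_Icc.2 (zero_le_one' ℝ)) hrc
  set S := h z / ω z ^ n with hS
  have hSle : ∀ x ∈ Icc (0:ℝ) 1, h x ≤ S * ω x ^ n := by
    intro x hx
    have h1 : h x / ω x ^ n ≤ S := hmax hx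
    rwa [div_le_iff₀ (by have := hω1 x hx; positivity)] at h1
  have hS0 : 0 ≤ S := div_nonneg (h0 z hz) (pow_nonneg (by linarith [hω1 z hz]) _)
  have hz1 : 1 ≤ ω z ^ n := one_le_pow₀ (hω1 z hz)
  have hcmp : ∫ t in z..1, p t * h t ≤ ∫ t in z..1, S * (p t * ω t ^ n) := by
    have hi1 : IntervalIntegrable (fun t => p t * h t) volume 0 1 := by
      simpa only [mul_comm] using IsPrim.intervalIntegrable_mul hc hp
    have hi2 : IntervalIntegrable (fun t => p t * ω t ^ n) volume 0 1 := by
      simpa only [mul_comm, Pi.pow_apply] using IsPrim.intervalIntegrable_mul (hωc.pow n) hp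
    refine intervalIntegral.integral_mono_on hz.2 (intervalIntegrable_sub_unit hi1 hz h1m)
      ((intervalIntegrable_sub_unit hi2 hz h1m).const_mul S) fun t ht => ?_
    have := hSle t ⟨hz.1.trans ht.1, ht.2⟩
    nlinarith [hp0 t, mul_le_mul_of_nonneg_left this (hp0 t)]
  rw [intervalIntegral.integral_const_mul] at hcmp
  have hz2 := hle z hz
  have hz3 := hint z hz
  have hz4 : h z = S * ω z ^ n := by
    rw [hS]; field_simp
  have hz5 : S * ω z ^ n ≤ A + S * (ω z ^ n / 2) := by
    have := mul_le_mul_of_nonneg_left hz3 hS0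
    linarith
  have hSA : S ≤ 2 * A := by nlinarith
  intro x hx
  calc h x ≤ S * ω x ^ n := hSle x hx
    _ ≤ 2 * A * (1 + N) ^ n := by
        have := hω1 x hx
        gcongr
        exact hωN x hx
    _ = _ := by ring

/-- Forward Grönwall inequality with an integrable weight. -/
lemma exists_gronwall_forward {p : ℝ → ℝ} (hp : IntervalIntegrable p volume 0 1)
    (hp0 : ∀ x, 0 ≤ p x) :
    ∃ C : ℝ, 0 ≤ C ∧ ∀ (h : ℝ → ℝ) (A : ℝ), 0 ≤ A → ContinuousOn h (Icc 0 1) →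
      (∀ x ∈ Icc (0:ℝ) 1, 0 ≤ h x) →
      (∀ x ∈ Icc (0:ℝ) 1, h x ≤ A + ∫ t in (0:ℝ)..x, p t * h t) →
      ∀ x ∈ Icc (0:ℝ) 1, h x ≤ C * A := by
  have hp' : IntervalIntegrable (fun x => p (1 - x)) volume 0 1 := by
    simpa using (hp.comp_sub_left 1).symm
  obtain ⟨C, hC, H⟩ := exists_gronwall_backward hp' (fun x => hp0 _)
  have hm : ∀ x ∈ Icc (0:ℝ) 1, 1 - x ∈ Icc (0:ℝ) 1 := fun x hx => by
    constructor <;> linarith [hx.1, hx.2]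
  refine ⟨C, hC, fun h A hA hc h0 hle x hx => ?_⟩
  have := H (fun x => h (1 - x)) A hA
    (hc.comp (by fun_prop) fun x hx => hm x hx) (fun x hx => h0 _ (hm x hx)) (fun x hx => by
      have h1 := hle _ (hm x hx)
      have h2 := intervalIntegral.integral_comp_sub_left (a := x) (b := 1)
        (fun t => p t * h t) 1
      simp only [sub_self] at h2
      rw [h2]; exact h1) (1 - x) (hm x hx)
  simpa using this

end Gronwall

/-- `y` solves `-y'' + q y = E y` on `[0,1]`. -/
def IsSol (q : ℝ → ℝ) (E : ℂ) (y y' : ℝ → ℂ) : Prop :=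
  (∀ x ∈ Icc (0:ℝ) 1, HasDerivAt y (y' x) x) ∧ IsPrim y' (fun x => ((q x : ℂ) - E) * y x)

section Sol

variable {q p : ℝ → ℝ} {E F : ℂ} {y y' z z' : ℝ → ℂ}

lemma SchrodingerSol.isSol (h : SchrodingerSol (fun x => (q x : ℂ)) E y y') : IsSol q E y y' := by
  obtain ⟨hd, y'', hi, hy, he⟩ := h
  refine ⟨fun x hx => hd x hx.1, ?_⟩
  have h1 : IsPrim y' y'' := by
    refine ⟨?_, fun x hx => hy x hx.1⟩
    rw [intervalIntegrable_iff_integrableOn_Icc_of_le zero_le_one]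
    exact hi 1
  refine h1.congr ?_
  filter_upwards [he] with x hx hm
  have := hx hm.1
  linear_combination -this

lemma IsSol.isPrim (h : IsSol q E y y') : IsPrim y y' :=
  isPrim_of_hasDerivAt h.1 h.2.continuousOn

lemma IsSol.continuousOn (h : IsSol q E y y') : ContinuousOn y (Icc 0 1) :=
  h.isPrim.continuousOn

lemma IsSol.const_mul (h : IsSol q E y y') (c : ℂ) :
    IsSol q E (fun x => c * y x) (fun x => c * y' x) := by
  refine ⟨fun x hx => (h.1 x hx).const_mul c, ?_⟩
  convert h.2.const_mul c using 2 with x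
  ring

lemma IsSol.sub (h : IsSol q E y y') (g : IsSol q E z z') :
    IsSol q E (fun x => y x - z x) (fun x => y' x - z' x) := by
  refine ⟨fun x hx => (h.1 x hx).sub (g.1 x hx), ?_⟩
  convert h.2.sub g.2 using 2 with x
  ring

/-- The derivative of the Wronskian. -/
lemma IsSol.wronskian (h : IsSol q E y y') (g : IsSol p F z z') :
    IsPrim (fun x => y x * z' x - y' x * z x)
      (fun x => ((p x : ℂ) - F - (q x - E)) * (y x * z x)) := by
  refine ((h.isPrim.mul g.2).sub (h.2.mul g.isPrim)).congr (Filter.Eventually.of_forall ?_)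
  intro x _
  ring

lemma IsSol.wronskian_const (h : IsSol q E y y') (g : IsSol q E z z') {a b : ℝ}
    (ha : a ∈ Icc (0:ℝ) 1) (hb : b ∈ Icc (0:ℝ) 1) :
    y a * z' a - y' a * z a = y b * z' b - y' b * z b := by
  have := (h.wronskian g).sub_eq ha hb
  simp only [sub_self, zero_mul, intervalIntegral.integral_zero] at this
  linear_combination -this

/-- The function `sin (k s) / k`. -/
def sinKernel (k : ℂ) (s : ℝ) : ℂ :=
  (Complex.exp (Complex.I * k * s) - Complex.exp (-(Complex.I * k * s))) / (2 * Complex.I * k)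

lemma hasDerivAt_exp_mul (c : ℂ) (x : ℝ) :
    HasDerivAt (fun t : ℝ => Complex.exp (c * t)) (c * Complex.exp (c * x)) x := by
  have h1 : HasDerivAt (fun t : ℝ => c * (t : ℂ)) c x := by
    simpa using (Complex.ofRealCLM.hasDerivAt (x := x)).const_mul c
  simpa [mul_comm] using h1.cexp

lemma IsSol.exp (k : ℂ) : IsSol 0 (k ^ 2) (fun x => Complex.exp (Complex.I * k * x))
    (fun x => Complex.I * k * Complex.exp (Complex.I * k * x)) := by
  refine ⟨fun x _ => hasDerivAt_exp_mul _ x, isPrim_of_hasDerivAt (fun x _ => ?_) ?_⟩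
  · have := (hasDerivAt_exp_mul (Complex.I * k) x).const_mul (Complex.I * k)
    convert this using 1
    simp only [Pi.zero_apply, Complex.ofReal_zero]
    linear_combination (-k ^ 2 * Complex.exp (Complex.I * k * x)) * Complex.I_sq
  · fun_prop

lemma IsSol.variation_of_constants (h : IsSol q (E ^ 2) y y') (hE : E ≠ 0) {a x : ℝ}
    (ha : a ∈ Icc (0:ℝ) 1) (hx : x ∈ Icc (0:ℝ) 1) :
    y x = y a * ((Complex.exp (Complex.I * E * (x - a : ℝ))
        + Complex.exp (-(Complex.I * E * (x - a : ℝ)))) / 2)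
      + y' a * sinKernel E (x - a) + ∫ t in a..x, sinKernel E (x - t) * (q t * y t) := by
  have e1 := IsSol.exp E
  have e2 := IsSol.exp (-E)
  rw [neg_sq] at e2
  have g := ((e2.const_mul (Complex.exp (Complex.I * E * x))).sub
    (e1.const_mul (Complex.exp (-(Complex.I * E * x))))).const_mul (1 / (2 * Complex.I * E))
  have w := (h.wronskian g).sub_eq ha hx
  have hs : ∀ t : ℝ, 1 / (2 * Complex.I * E) * (Complex.exp (Complex.I * E * x)
      * Complex.exp (Complex.I * -E * t)
      - Complex.exp (-(Complex.I * E * x)) * Complex.exp (Complex.I * E * t))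
      = sinKernel E (x - t) := by
    intro t
    rw [sinKernel, ← Complex.exp_add, ← Complex.exp_add]
    push_cast
    ring_nf
  have hs' : ∀ t : ℝ, 1 / (2 * Complex.I * E) * (Complex.exp (Complex.I * E * x)
      * (Complex.I * -E * Complex.exp (Complex.I * -E * t))
      - Complex.exp (-(Complex.I * E * x)) * (Complex.I * E * Complex.exp (Complex.I * E * t)))
      = -((Complex.exp (Complex.I * E * (x - t : ℝ))
        + Complex.exp (-(Complex.I * E * (x - t : ℝ)))) / 2) := by
    intro t
    have a1 : Complex.exp (Complex.I * E * (x - t : ℝ))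
        = Complex.exp (Complex.I * E * x) * Complex.exp (Complex.I * -E * t) := by
      rw [← Complex.exp_add]; push_cast; ring_nf
    have a2 : Complex.exp (-(Complex.I * E * (x - t : ℝ)))
        = Complex.exp (-(Complex.I * E * x)) * Complex.exp (Complex.I * E * t) := by
      rw [← Complex.exp_add]; push_cast; ring_nf
    rw [a1, a2]
    have := Complex.I_ne_zero
    field_simp
    ring
  simp only [hs, hs'] at w
  have hint : ∫ t in a..x, ((0 : ℝ → ℝ) t - E ^ 2 - (q t - E ^ 2) : ℂ) * (y t * sinKernel E (x - t))
      = - ∫ t in a..x, sinKernel E (x - t) * (q t * y t) := by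
    rw [← intervalIntegral.integral_neg]
    congr 1
    ext t
    simp only [Pi.zero_apply, Complex.ofReal_zero]
    ring
  rw [hint] at w
  have h0 : sinKernel E (x - x) = 0 := by simp [sinKernel]
  rw [h0] at w
  simp only [sub_self, Complex.ofReal_zero, mul_zero, neg_zero, Complex.exp_zero] at w
  linear_combination -w

lemma norm_exp_I_mul (k : ℂ) (s : ℝ) : ‖Complex.exp (Complex.I * k * s)‖ = Real.exp (-(k.im * s)) := by
  rw [Complex.norm_exp]; congr 1; simp

lemma norm_sinKernel_le {k : ℂ} (hk : k ≠ 0) {s : ℝ} (hs : |s| ≤ 1) :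
    ‖sinKernel k s‖ ≤ 2 * Real.exp (|k.im| * |s|) / (1 + ‖k‖) := by
  have hk' : 0 < ‖k‖ := norm_pos_iff.2 hk
  set M := Real.exp (|k.im| * |s|) with hM
  have hb : ∀ t ∈ Icc (-1:ℝ) 1, ‖Complex.exp ((Complex.I * k * s) * t)‖ ≤ M := by
    intro t ht
    have : (Complex.I * k * s) * t = Complex.I * k * ((s * t : ℝ) : ℂ) := by push_cast; ring
    rw [this, norm_exp_I_mul, hM]
    apply Real.exp_le_exp.2
    calc -(k.im * (s * t)) ≤ |-(k.im * (s * t))| := le_abs_self _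
      _ = |k.im| * |s| * |t| := by rw [abs_neg, abs_mul, abs_mul]; ring
      _ ≤ |k.im| * |s| * 1 := by gcongr; exact abs_le.2 ht
      _ = _ := by ring
  have hn : ‖Complex.exp (Complex.I * k * s) - Complex.exp (-(Complex.I * k * s))‖
      ≤ 2 * M := by
    have h1 := hb 1 (by simp)
    have h2 := hb (-1) (by simp)
    simp only [Complex.ofReal_one, mul_one, Complex.ofReal_neg, mul_neg] at h1 h2
    linarith [norm_sub_le (Complex.exp (Complex.I * k * s)) (Complex.exp (-(Complex.I * k * s)))]
  have hn' : ‖Complex.exp (Complex.I * k * s) - Complex.exp (-(Complex.I * k * s))‖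
      ≤ 2 * ‖k‖ * M := by
    have := (convex_Icc (-1:ℝ) 1).norm_image_sub_le_of_norm_hasDerivWithin_le
      (f := fun t : ℝ => Complex.exp ((Complex.I * k * s) * t)) (C := ‖k‖ * M)
      (fun t _ => (hasDerivAt_exp_mul (Complex.I * k * s) t).hasDerivWithinAt)
      (fun t ht => by
        rw [norm_mul]
        have : ‖Complex.I * k * s‖ ≤ ‖k‖ := by
          simp only [norm_mul, Complex.norm_I, one_mul, Complex.norm_real, Real.norm_eq_abs]
          nlinarith
        gcongr
        exact hb t ht) (x := -1) (y := 1) (by simp) (by simp)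
    norm_num at this
    linarith
  have hn2 : ‖(2 * Complex.I * k : ℂ)‖ = 2 * ‖k‖ := by simp
  rw [sinKernel, norm_div, hn2, div_le_div_iff₀ (by positivity) (by positivity)]
  nlinarith

end Sol

section Jost

variable {q : ℝ → ℝ} {k : ℂ} {y y' : ℝ → ℂ}

lemma norm_integral_sinKernel_le (hq : IntervalIntegrable q volume 0 1)
    (hy : ContinuousOn y (Icc 0 1)) (hk : k ≠ 0) {a b x σ : ℝ} (ha : a ∈ Icc (0:ℝ) 1)
    (hb : b ∈ Icc (0:ℝ) 1) (hab : a ≤ b) (hx : x ∈ Icc (0:ℝ) 1)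
    (hσ : ∀ t ∈ Icc a b, |k.im| * |x - t| = σ * (x - t)) :
    ‖∫ t in a..b, sinKernel k (x - t) * (q t * y t)‖
      ≤ Real.exp (σ * x) / (1 + ‖k‖) * ∫ t in a..b, 2 * |q t| * (‖y t‖ * Real.exp (-(σ * t))) := by
  rw [← intervalIntegral.integral_const_mul]
  apply intervalIntegral.norm_integral_le_of_norm_le hab
  · refine Filter.Eventually.of_forall fun t ht => ?_
    have ht' : t ∈ Icc a b := ⟨ht.1.le, ht.2⟩
    have h1 : |x - t| ≤ 1 := by
      rw [abs_le]; constructor <;> linarith [hx.1, hx.2, ht'.1, ht'.2, ha.1, hb.2]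
    have h2 := norm_sinKernel_le hk h1
    rw [hσ t ht'] at h2
    have h3 : Real.exp (σ * (x - t)) = Real.exp (σ * x) * Real.exp (-(σ * t)) := by
      rw [← Real.exp_add]; ring_nf
    rw [norm_mul, norm_mul, Complex.norm_real, Real.norm_eq_abs]
    calc _ ≤ (2 * Real.exp (σ * (x - t)) / (1 + ‖k‖)) * (|q t| * ‖y t‖) := by gcongr
      _ = _ := by rw [h3]; ring
  · refine IntervalIntegrable.const_mul (intervalIntegrable_sub_unit ?_ ha hb) _
    have : ContinuousOn (fun t => ‖y t‖ * Real.exp (-(σ * t))) (Icc 0 1) :=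
      hy.norm.mul (by fun_prop)
    simpa only [mul_comm] using IsPrim.intervalIntegrable_mul this (hq.abs.const_mul 2)

lemma IsJost.isSol (h : IsJost (fun x => (q x : ℂ)) k y y') : IsSol q (k ^ 2) y y' :=
  SchrodingerSol.isSol h.1

lemma IsJost.apply_one (h : IsJost (fun x => (q x : ℂ)) k y y') :
    y 1 = Complex.exp (Complex.I * k) := by
  simpa using h.2 1 le_rfl

lemma IsJost.deriv_one (h : IsJost (fun x => (q x : ℂ)) k y y') :
    y' 1 = Complex.I * k * Complex.exp (Complex.I * k) := by
  have h1 := (h.1.1 1 zero_le_one).hasDerivWithinAt (s := Ici 1)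
  have h2 := (hasDerivAt_exp_mul (Complex.I * k) 1).hasDerivWithinAt (s := Ici 1)
  have h3 := h2.congr (f₁ := y) (fun x hx => h.2 x hx) (h.2 1 le_rfl)
  simpa using (uniqueDiffWithinAt_Ici (1:ℝ)).eq_deriv _ h1 h3

lemma IsJost.integral_eq (h : IsJost (fun x => (q x : ℂ)) k y y') (hk : k ≠ 0) {x : ℝ}
    (hx : x ∈ Icc (0:ℝ) 1) :
    y x = Complex.exp (Complex.I * k * x) - ∫ t in x..1, sinKernel k (x - t) * (q t * y t) := by
  have := h.isSol.variation_of_constants hk (right_mem_Icc.2 zero_le_one) hx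
  rw [h.apply_one, h.deriv_one, intervalIntegral.integral_symm, sinKernel] at this
  rw [this]
  have e : Complex.exp (Complex.I * k * x)
      = Complex.exp (Complex.I * k) * Complex.exp (Complex.I * k * (x - 1 : ℝ)) := by
    rw [← Complex.exp_add]; push_cast; ring_nf
  rw [e]
  have := Complex.I_ne_zero
  field_simp
  ring

/-- Bounds on the Jost solution: growth in `k`, and the high energy asymptotics in the closed upper
half plane. -/
lemma exists_jost_bound (hq : IntervalIntegrable q volume 0 1) :
    ∃ C : ℝ, 0 ≤ C ∧ ∀ (k : ℂ) (y y' : ℝ → ℂ), k ≠ 0 → IsJost (fun x => (q x : ℂ)) k y y' →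
      ∀ x ∈ Icc (0:ℝ) 1,
        ‖y x‖ ≤ C * Real.exp (|k.im| - k.im) * Real.exp (-(|k.im| * x)) ∧
        (0 ≤ k.im → ‖y x - Complex.exp (Complex.I * k * x)‖
          ≤ C * Real.exp (-(k.im * x)) / (1 + ‖k‖)) := by
  have hp : IntervalIntegrable (fun t => 2 * |q t|) volume 0 1 := hq.abs.const_mul 2
  have hp0 : ∀ t, 0 ≤ 2 * |q t| := fun t => by positivity
  have h0m : (0:ℝ) ∈ Icc (0:ℝ) 1 := by simp
  have h1m : (1:ℝ) ∈ Icc (0:ℝ) 1 := by simp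
  obtain ⟨C, hC, H⟩ := exists_gronwall_backward hp hp0
  set N : ℝ := ∫ t in (0:ℝ)..1, 2 * |q t| with hN
  have hN0 : 0 ≤ N := intervalIntegral.integral_nonneg zero_le_one fun t _ => hp0 t
  have key : ∀ (k : ℂ) (y y' : ℝ → ℂ), k ≠ 0 → IsJost (fun x => (q x : ℂ)) k y y' →
      ∀ x ∈ Icc (0:ℝ) 1, ‖∫ t in x..1, sinKernel k (x - t) * (q t * y t)‖
        ≤ Real.exp (-(|k.im| * x)) / (1 + ‖k‖)
          * ∫ t in x..1, 2 * |q t| * (‖y t‖ * Real.exp (|k.im| * t)) := by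
    intro k y y' hk h x hx
    have := norm_integral_sinKernel_le (σ := -|k.im|) hq h.isSol.continuousOn hk hx h1m hx.2 hx
      (fun t ht => by rw [abs_of_nonpos (sub_nonpos.2 ht.1)]; ring)
    simpa only [neg_mul, neg_neg] using this
  have bound : ∀ (k : ℂ) (y y' : ℝ → ℂ), k ≠ 0 → IsJost (fun x => (q x : ℂ)) k y y' →
      ∀ x ∈ Icc (0:ℝ) 1, ‖y x‖ * Real.exp (|k.im| * x) ≤ C * Real.exp (|k.im| - k.im) := by
    intro k y y' hk h
    have hyc := h.isSol.continuousOn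
    refine H (fun x => ‖y x‖ * Real.exp (|k.im| * x)) _ (Real.exp_pos _).le
      (hyc.norm.mul (by fun_prop)) (fun x _ => by positivity) fun x hx => ?_
    have h1 := key k y y' hk h x hx
    set J := ∫ t in x..1, 2 * |q t| * (‖y t‖ * Real.exp (|k.im| * t))
    have hJ : 0 ≤ J := intervalIntegral.integral_nonneg hx.2 fun t _ => by positivity
    have h2 : ‖y x‖ ≤ Real.exp (-(k.im * x)) + Real.exp (-(|k.im| * x)) / (1 + ‖k‖) * J := by
      rw [h.integral_eq hk hx]
      refine (norm_sub_le _ _).trans ?_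
      rw [norm_exp_I_mul]
      linarith
    have h3 : Real.exp (-(|k.im| * x)) / (1 + ‖k‖) ≤ Real.exp (-(|k.im| * x)) :=
      div_le_self (Real.exp_pos _).le (by linarith [norm_nonneg k])
    calc ‖y x‖ * Real.exp (|k.im| * x)
        ≤ (Real.exp (-(k.im * x)) + Real.exp (-(|k.im| * x)) * J) * Real.exp (|k.im| * x) := by
          gcongr
          exact h2.trans (by gcongr)
      _ = Real.exp ((|k.im| - k.im) * x) + J := by
          rw [add_mul, mul_right_comm, ← Real.exp_add, ← Real.exp_add, neg_add_cancel,
            Real.exp_zero, one_mul]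
          ring_nf
      _ ≤ _ := by
          gcongr
          have := le_abs_self k.im
          nlinarith [hx.2]
  refine ⟨max C (C * N), le_max_of_le_left hC, fun k y y' hk h x hx => ⟨?_, fun hi => ?_⟩⟩
  · have := bound k y y' hk h x hx
    rw [Real.exp_neg, ← div_eq_mul_inv, le_div_iff₀ (Real.exp_pos _)]
    refine this.trans ?_
    gcongr
    exact le_max_left _ _
  · have h1 := key k y y' hk h x hx
    have h2 : ‖y x - Complex.exp (Complex.I * k * x)‖
        = ‖∫ t in x..1, sinKernel k (x - t) * (q t * y t)‖ := by
      conv_lhs => rw [h.integral_eq hk hx]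
      rw [sub_sub_cancel_left, norm_neg]
    have hyc := h.isSol.continuousOn
    have h3 : ∫ t in x..1, 2 * |q t| * (‖y t‖ * Real.exp (|k.im| * t)) ≤ C * N := by
      calc _ ≤ ∫ t in x..1, C * (2 * |q t|) := by
            refine intervalIntegral.integral_mono_on hx.2 (intervalIntegrable_sub_unit ?_ hx h1m)
              (intervalIntegrable_sub_unit (hp.const_mul C) hx h1m) fun t ht => ?_
            · have : ContinuousOn (fun t => ‖y t‖ * Real.exp (|k.im| * t)) (Icc 0 1) :=
                hyc.norm.mul (by fun_prop)
              simpa only [mul_comm] using IsPrim.intervalIntegrable_mul this hp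
            · have := bound k y y' hk h t ⟨hx.1.trans ht.1, ht.2⟩
              rw [abs_of_nonneg hi, sub_self, Real.exp_zero, mul_one] at this
              rw [abs_of_nonneg hi]
              nlinarith [mul_le_mul_of_nonneg_left this (hp0 t)]
        _ ≤ _ := by
            rw [intervalIntegral.integral_const_mul]
            gcongr
            exact intervalIntegral.integral_mono_interval hx.1 hx.2 le_rfl
              (Filter.Eventually.of_forall hp0) hp
    rw [h2]
    refine h1.trans ?_
    rw [abs_of_nonneg hi] at h3 ⊢
    calc _ ≤ Real.exp (-(k.im * x)) / (1 + ‖k‖) * (max C (C * N)) := by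
          gcongr
          exact h3.trans (le_max_right _ _)
      _ = _ := by ring

/-- Bound on the regular solution. -/
lemma exists_regular_bound (hq : IntervalIntegrable q volume 0 1) :
    ∃ C : ℝ, 0 ≤ C ∧ ∀ (k : ℂ) (y y' : ℝ → ℂ), k ≠ 0 → IsSol q (k ^ 2) y y' → y 0 = 0 → y' 0 = 1 →
      ∀ x ∈ Icc (0:ℝ) 1, ‖y x‖ ≤ C * Real.exp (|k.im| * x) / (1 + ‖k‖) := by
  have hp : IntervalIntegrable (fun t => 2 * |q t|) volume 0 1 := hq.abs.const_mul 2
  have h0m : (0:ℝ) ∈ Icc (0:ℝ) 1 := by simp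
  obtain ⟨C, hC, H⟩ := exists_gronwall_forward hp (fun t => by positivity)
  refine ⟨C * 2, by positivity, fun k y y' hk h y0 y1 x hx => ?_⟩
  have hyc := h.continuousOn
  have hk1 : 0 < 1 + ‖k‖ := by positivity
  have := H (fun x => (1 + ‖k‖) * (‖y x‖ * Real.exp (-(|k.im| * x)))) 2 zero_le_two
    (continuousOn_const.mul (hyc.norm.mul (by fun_prop))) (fun x _ => by positivity)
    (fun x hx => ?_) x hx
  · rw [Real.exp_neg, ← div_eq_mul_inv, ← mul_div_assoc, div_le_iff₀ (Real.exp_pos _)] at this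
    rw [le_div_iff₀ hk1]
    linarith
  · have h1 := norm_integral_sinKernel_le (σ := |k.im|) hq hyc hk h0m hx hx.1 hx
      (fun t ht => by rw [abs_of_nonneg (sub_nonneg.2 ht.2)])
    have h2 := h.variation_of_constants hk h0m hx
    rw [y0, y1, zero_mul, zero_add, one_mul, sub_zero] at h2
    have h3 := norm_sinKernel_le hk (s := x) (by rw [abs_of_nonneg hx.1]; exact hx.2)
    rw [abs_of_nonneg hx.1] at h3
    set J := ∫ t in (0:ℝ)..x, 2 * |q t| * (‖y t‖ * Real.exp (-(|k.im| * t))) with hJ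
    have e : ∫ t in (0:ℝ)..x, 2 * |q t| * ((1 + ‖k‖) * (‖y t‖ * Real.exp (-(|k.im| * t))))
        = (1 + ‖k‖) * J := by
      rw [hJ, ← intervalIntegral.integral_const_mul]
      congr 1; ext t; ring
    rw [e]
    have hJ0 : 0 ≤ J := intervalIntegral.integral_nonneg hx.1 fun t _ => by positivity
    calc (1 + ‖k‖) * (‖y x‖ * Real.exp (-(|k.im| * x)))
        ≤ (1 + ‖k‖) * ((2 * Real.exp (|k.im| * x) / (1 + ‖k‖)
          + Real.exp (|k.im| * x) / (1 + ‖k‖) * J) * Real.exp (-(|k.im| * x))) := by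
          gcongr
          rw [h2]
          exact (norm_add_le _ _).trans (add_le_add h3 h1)
      _ = 2 + J := by
          rw [Real.exp_neg]
          field_simp
      _ ≤ _ := by nlinarith [norm_nonneg k]

end Jost

section Family

variable {q : ℝ → ℝ} {f f' : ℂ → ℝ → ℂ}

lemma isSol_neg (hf : ∀ k : ℂ, IsJost (fun x => (q x : ℂ)) k (f k) (f' k)) (k : ℂ) :
    IsSol q (k ^ 2) (f (-k)) (f' (-k)) := by
  have := (hf (-k)).isSol
  rwa [neg_sq] at this

lemma jost_wronskian (hf : ∀ k : ℂ, IsJost (fun x => (q x : ℂ)) k (f k) (f' k)) (k : ℂ) {x : ℝ}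
    (hx : x ∈ Icc (0:ℝ) 1) :
    f k x * f' (-k) x - f' k x * f (-k) x = -(2 * Complex.I * k) := by
  rw [(hf k).isSol.wronskian_const (isSol_neg hf k) hx (right_mem_Icc.2 zero_le_one),
    (hf k).apply_one, (hf k).deriv_one, (hf (-k)).apply_one, (hf (-k)).deriv_one]
  have : Complex.exp (Complex.I * k) * Complex.exp (Complex.I * -k) = 1 := by
    rw [← Complex.exp_add]; simp
  linear_combination (-(2 * Complex.I * k)) * this

/-- The solution with vanishing value and unit derivative at a given point, in terms of Jost
solutions. -/
lemma isSol_regular (hf : ∀ k : ℂ, IsJost (fun x => (q x : ℂ)) k (f k) (f' k)) {k : ℂ}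
    (hk : k ≠ 0) {x : ℝ} (hx : x ∈ Icc (0:ℝ) 1) :
    ∃ s s' : ℝ → ℂ, IsSol q (k ^ 2) s s' ∧ s x = 0 ∧ s' x = 1 ∧
      (∀ t, s t = 1 / (2 * Complex.I * k) * (f (-k) x * f k t - f k x * f (-k) t)) ∧
      ∀ t, s' t = 1 / (2 * Complex.I * k) * (f (-k) x * f' k t - f k x * f' (-k) t) := by
  refine ⟨_, _, (((hf k).isSol.const_mul (f (-k) x)).sub
    ((isSol_neg hf k).const_mul (f k x))).const_mul (1 / (2 * Complex.I * k)),
    ?_, ?_, fun t => rfl, fun t => rfl⟩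
  · ring
  · have := jost_wronskian hf k hx
    have hI := Complex.I_ne_zero
    rw [show f (-k) x * f' k x - f k x * f' (-k) x = 2 * Complex.I * k by linear_combination -this]
    field_simp

lemma exists_bound_on_ball (hq : IntervalIntegrable q volume 0 1)
    (hf : ∀ k : ℂ, IsJost (fun x => (q x : ℂ)) k (f k) (f' k)) (R : ℝ) :
    ∃ M : ℝ, ∀ k : ℂ, k ≠ 0 → ‖k‖ ≤ R → ∀ x ∈ Icc (0:ℝ) 1, ‖f k x‖ ≤ M := by
  obtain ⟨C, hC, H⟩ := exists_jost_bound hq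
  refine ⟨C * Real.exp (2 * R) * 1, fun k hk hR x hx => (H k _ _ hk (hf k) x hx).1.trans ?_⟩
  have h1 : |k.im| ≤ R := (Complex.abs_im_le_norm k).trans hR
  have h2 := neg_abs_le k.im
  gcongr
  · linarith
  · rw [Real.exp_le_one_iff]
    have := mul_nonneg (abs_nonneg k.im) hx.1
    linarith

lemma differentiableAt_sub_mul {G : ℂ → ℂ} {z : ℂ} (hG : ContinuousAt G z) :
    DifferentiableAt ℂ (fun k => (k - z) * G k) z := by
  have : HasDerivAt (fun k => (k - z) * G k) (G z) z := by
    rw [hasDerivAt_iff_tendsto_slope]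
    refine (hG.tendsto.mono_left nhdsWithin_le_nhds).congr' ?_
    filter_upwards [self_mem_nhdsWithin] with k hk
    have : k - z ≠ 0 := sub_ne_zero.2 hk
    rw [slope_def_field]
    field_simp
    ring
  exact this.differentiableAt

lemma jost_eq_integral (hf : ∀ k : ℂ, IsJost (fun x => (q x : ℂ)) k (f k) (f' k)) {k z : ℂ}
    {x : ℝ} (hx : x ∈ Icc (0:ℝ) 1) {s s' : ℝ → ℂ} (hs : IsSol q (z ^ 2) s s') (s0 : s x = 0)
    (s1 : s' x = 1) :
    f k x = Complex.exp (Complex.I * k) * (s' 1 - Complex.I * k * s 1)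
      - (k - z) * ((k + z) * ∫ t in x..1, f k t * s t) := by
  have h := ((hf k).isSol.wronskian hs).sub_eq hx (right_mem_Icc.2 zero_le_one)
  have e : ∫ t in x..1, ((q t : ℂ) - z ^ 2 - (q t - k ^ 2)) * (f k t * s t)
      = (k ^ 2 - z ^ 2) * ∫ t in x..1, f k t * s t := by
    rw [← intervalIntegral.integral_const_mul]
    congr 1; ext t; ring
  rw [e, s0, s1, (hf k).apply_one, (hf k).deriv_one] at h
  linear_combination -h

lemma eventually_norm_le (hq : IntervalIntegrable q volume 0 1)
    (hf : ∀ k : ℂ, IsJost (fun x => (q x : ℂ)) k (f k) (f' k)) {z : ℂ} (hz : z ≠ 0) :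
    ∃ M : ℝ, ∀ᶠ k in nhds z, ∀ x ∈ Icc (0:ℝ) 1, ‖f k x‖ ≤ M := by
  obtain ⟨M, hM⟩ := exists_bound_on_ball hq hf (‖z‖ + 1)
  refine ⟨M, ?_⟩
  have h1 : ∀ᶠ k in nhds z, ‖k‖ < ‖z‖ + 1 :=
    continuous_norm.continuousAt.eventually_lt continuousAt_const (by simp)
  filter_upwards [h1, isOpen_ne.mem_nhds hz] with k hk hk0 using hM k hk0 hk.le

lemma continuousAt_jost (hq : IntervalIntegrable q volume 0 1)
    (hf : ∀ k : ℂ, IsJost (fun x => (q x : ℂ)) k (f k) (f' k)) {z : ℂ} (hz : z ≠ 0) {x : ℝ}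
    (hx : x ∈ Icc (0:ℝ) 1) : ContinuousAt (fun k => f k x) z := by
  obtain ⟨s, s', hs, s0, s1, -⟩ := isSol_regular hf hz hx
  have e : (fun k => f k x) = fun k => Complex.exp (Complex.I * k) * (s' 1 - Complex.I * k * s 1)
      - (k - z) * ((k + z) * ∫ t in x..1, f k t * s t) :=
    funext fun k => jost_eq_integral hf hx hs s0 s1
  rw [e]
  refine ContinuousAt.sub (by fun_prop) ?_
  obtain ⟨M, hM⟩ := eventually_norm_le hq hf hz
  obtain ⟨K, hK⟩ := isCompact_Icc.exists_bound_of_continuousOn hs.continuousOn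
  have hb : ∀ᶠ k in nhds z, ‖∫ t in x..1, f k t * s t‖ ≤ M * K := by
    filter_upwards [hM] with k hk
    have h1 : 0 ≤ M := (norm_nonneg _).trans (hk x hx)
    have h2 : 0 ≤ K := (norm_nonneg _).trans (hK x hx)
    have := intervalIntegral.norm_integral_le_of_norm_le_const (a := x) (b := 1)
      (f := fun t => f k t * s t) (C := M * K) fun t ht => by
        rw [uIoc_of_le hx.2] at ht
        have ht' : t ∈ Icc (0:ℝ) 1 := ⟨hx.1.trans ht.1.le, ht.2⟩
        rw [norm_mul]
        exact mul_le_mul (hk t ht') (hK t ht') (norm_nonneg _) h1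
    refine this.trans (mul_le_of_le_one_right (by positivity) ?_)
    rw [abs_of_nonneg (sub_nonneg.2 hx.2)]
    linarith [hx.1]
  have hlim : Filter.Tendsto (fun k => ‖k - z‖ * (‖k + z‖ * (M * K))) (nhds z) (nhds 0) := by
    have : ContinuousAt (fun k => ‖k - z‖ * (‖k + z‖ * (M * K))) z := by fun_prop
    simpa [ContinuousAt] using this
  rw [ContinuousAt]
  simp only [sub_self, zero_mul]
  refine squeeze_zero_norm' ?_ hlim
  filter_upwards [hb] with k hk
  rw [norm_mul, norm_mul]
  gcongr

/-- Away from `0`, the Jost solution depends holomorphically on `k`. -/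
lemma differentiableAt_jost (hq : IntervalIntegrable q volume 0 1)
    (hf : ∀ k : ℂ, IsJost (fun x => (q x : ℂ)) k (f k) (f' k)) {z : ℂ} (hz : z ≠ 0) {x : ℝ}
    (hx : x ∈ Icc (0:ℝ) 1) : DifferentiableAt ℂ (fun k => f k x) z := by
  obtain ⟨s, s', hs, s0, s1, -⟩ := isSol_regular hf hz hx
  have e : (fun k => f k x) = fun k => Complex.exp (Complex.I * k) * (s' 1 - Complex.I * k * s 1)
      - (k - z) * ((k + z) * ∫ t in x..1, f k t * s t) :=
    funext fun k => jost_eq_integral hf hx hs s0 s1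
  rw [e]
  refine DifferentiableAt.sub (by fun_prop) (differentiableAt_sub_mul ?_)
  refine ContinuousAt.mul (by fun_prop) ?_
  obtain ⟨M, hM⟩ := eventually_norm_le hq hf hz
  have hsub : uIoc x 1 ⊆ Icc (0:ℝ) 1 := by
    rw [uIoc_of_le hx.2]
    exact fun t ht => ⟨hx.1.trans ht.1.le, ht.2⟩
  refine intervalIntegral.continuousAt_of_dominated_interval (bound := fun t => M * ‖s t‖) ?_ ?_ ?_
    ?_
  · refine Filter.Eventually.of_forall fun k => ?_
    exact (((hf k).isSol.continuousOn.mul hs.continuousOn).mono hsub).aestronglyMeasurable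
      measurableSet_uIoc
  · filter_upwards [hM] with k hk
    refine Filter.Eventually.of_forall fun t ht => ?_
    rw [norm_mul]
    exact mul_le_mul_of_nonneg_right (hk t (hsub ht)) (norm_nonneg _)
  · apply ContinuousOn.intervalIntegrable
    rw [uIcc_of_le hx.2]
    exact continuousOn_const.mul (hs.continuousOn.norm.mono (Icc_subset_Icc_left hx.1))
  · exact Filter.Eventually.of_forall fun t ht =>
      (continuousAt_jost hq hf hz (hsub ht)).mul continuousAt_const

lemma exists_jost_lower_bound (hq : IntervalIntegrable q volume 0 1)
    (hf : ∀ k : ℂ, IsJost (fun x => (q x : ℂ)) k (f k) (f' k)) :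
    ∃ R : ℝ, 0 < R ∧ ∀ k : ℂ, 0 ≤ k.im → R ≤ ‖k‖ → ∀ x ∈ Icc (0:ℝ) 1,
      Real.exp (-(k.im * x)) / 2 ≤ ‖f k x‖ := by
  obtain ⟨C, hC, H⟩ := exists_jost_bound hq
  refine ⟨2 * C + 1, by positivity, fun k hi hk x hx => ?_⟩
  have hk0 : k ≠ 0 := by
    rintro rfl
    rw [norm_zero] at hk
    linarith
  have h1 := (H k _ _ hk0 (hf k) x hx).2 hi
  have h2 := norm_sub_norm_le (Complex.exp (Complex.I * k * x)) (f k x)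
  rw [norm_exp_I_mul, norm_sub_rev] at h2
  have h3 : C * Real.exp (-(k.im * x)) / (1 + ‖k‖) ≤ Real.exp (-(k.im * x)) / 2 := by
    rw [div_le_div_iff₀ (by positivity) two_pos]
    nlinarith [Real.exp_pos (-(k.im * x))]
  linarith

end Family

/-- An odd bounded holomorphic function on the punctured plane vanishes. -/
lemma eq_zero_of_odd_of_bounded {G : ℂ → ℂ} (hd : ∀ z, z ≠ 0 → DifferentiableAt ℂ G z)
    (hodd : ∀ z, G (-z) = -G z) {M : ℝ} (hb : ∀ z, z ≠ 0 → ‖G z‖ ≤ M) {z : ℂ} (hz : z ≠ 0) :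
    G z = 0 := by
  have hU : (univ : Set ℂ) ∈ nhds (0:ℂ) := Filter.univ_mem
  have h1 := Complex.differentiableOn_update_limUnder_of_bddAbove hU
    (f := G) (fun z hz => (hd z hz.2).differentiableWithinAt)
    ⟨M, by rintro _ ⟨z, hz, rfl⟩; exact hb z hz.2⟩
  rw [differentiableOn_univ] at h1
  set g := Function.update G 0 ((nhdsWithin 0 {0}ᶜ).limUnder G) with hg
  have hgz : ∀ z, z ≠ 0 → g z = G z := fun z hz => by rw [hg, Function.update_of_ne hz]
  have hbd : Bornology.IsBounded (range g) := by
    rw [isBounded_iff_forall_norm_le]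
    refine ⟨max M ‖g 0‖, ?_⟩
    rintro _ ⟨z, rfl⟩
    by_cases hz : z = 0
    · rw [hz]; exact le_max_right _ _
    · rw [hgz z hz]; exact (hb z hz).trans (le_max_left _ _)
  have h2 := h1.apply_eq_apply_of_bounded hbd z (-z)
  rw [hgz z hz, hgz (-z) (neg_ne_zero.2 hz), hodd] at h2
  exact self_eq_neg.1 h2

section Pair

variable {q₁ q₂ : ℝ → ℝ} {f₁ f₁' f₂ f₂' : ℂ → ℝ → ℂ}

/-- The difference of the two sides of the equation between S-matrices, and its analogue at an
arbitrary point `x`. -/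
def cross (f₁ f₂ : ℂ → ℝ → ℂ) (x : ℝ) (k : ℂ) : ℂ := f₁ (-k) x * f₂ k x - f₂ (-k) x * f₁ k x

lemma cross_neg (x : ℝ) (k : ℂ) : cross f₁ f₂ x (-k) = -cross f₁ f₂ x k := by
  rw [cross, cross, neg_neg]; ring

variable (hq₁ : IntervalIntegrable q₁ volume 0 1) (hq₂ : IntervalIntegrable q₂ volume 0 1)
  (hf₁ : ∀ k : ℂ, IsJost (fun x => (q₁ x : ℂ)) k (f₁ k) (f₁' k))
  (hf₂ : ∀ k : ℂ, IsJost (fun x => (q₂ x : ℂ)) k (f₂ k) (f₂' k))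

include hq₁ hq₂ hf₁ hf₂

lemma differentiableAt_cross {x : ℝ} (hx : x ∈ Icc (0:ℝ) 1) {z : ℂ} (hz : z ≠ 0) :
    DifferentiableAt ℂ (cross f₁ f₂ x) z := by
  have h1 := differentiableAt_jost hq₁ hf₁ hz hx
  have h2 := differentiableAt_jost hq₂ hf₂ hz hx
  have hn : DifferentiableAt ℂ (fun k : ℂ => -k) z := by fun_prop
  have h3 := (differentiableAt_jost hq₁ hf₁ (neg_ne_zero.2 hz) hx).comp z hn
  have h4 := (differentiableAt_jost hq₂ hf₂ (neg_ne_zero.2 hz) hx).comp z hn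
  exact (h3.mul h2).sub (h4.mul h1)

lemma exists_cross_bound : ∃ C : ℝ, 0 ≤ C ∧ ∀ k : ℂ, k ≠ 0 →
    ‖cross f₁ f₂ 0 k‖ ≤ C * ‖k‖ * Real.exp (2 * |k.im|) / (1 + ‖k‖) ^ 2 := by
  obtain ⟨C₁, hC₁, H₁⟩ := exists_regular_bound hq₁
  obtain ⟨C₂, hC₂, H₂⟩ := exists_regular_bound hq₂
  have h0m : (0:ℝ) ∈ Icc (0:ℝ) 1 := by simp
  have h1m : (1:ℝ) ∈ Icc (0:ℝ) 1 := by simp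
  have hD : IntervalIntegrable (fun t => |q₂ t - q₁ t|) volume 0 1 := (hq₂.sub hq₁).abs
  set N := ∫ t in (0:ℝ)..1, |q₂ t - q₁ t| with hN
  have hN0 : 0 ≤ N := intervalIntegral.integral_nonneg zero_le_one fun t _ => abs_nonneg _
  refine ⟨2 * (N * (C₁ * C₂)), by positivity, fun k hk => ?_⟩
  obtain ⟨s, s', hs, s0, s1, es, es'⟩ := isSol_regular hf₁ hk h0m
  obtain ⟨u, u', hu, u0, u1, eu, eu'⟩ := isSol_regular hf₂ hk h0m
  have w := (hs.wronskian hu).sub_eq h0m h1m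
  rw [s0, u0, es, es', eu, eu', (hf₁ k).apply_one, (hf₁ k).deriv_one, (hf₁ (-k)).apply_one,
    (hf₁ (-k)).deriv_one, (hf₂ k).apply_one, (hf₂ k).deriv_one, (hf₂ (-k)).apply_one,
    (hf₂ (-k)).deriv_one] at w
  have hE : Complex.exp (Complex.I * k) * Complex.exp (Complex.I * -k) = 1 := by
    rw [← Complex.exp_add]; simp
  set J := ∫ t in (0:ℝ)..1, ((q₂ t : ℂ) - k ^ 2 - (q₁ t - k ^ 2)) * (s t * u t) with hJ
  have hI := Complex.I_ne_zero
  have e : cross f₁ f₂ 0 k = 2 * Complex.I * k * J := by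
    rw [← w, cross]
    generalize Complex.exp (Complex.I * k) = a at hE
    generalize Complex.exp (Complex.I * -k) = b at hE
    field_simp
    linear_combination (-2 * (f₁ (-k) 0 * f₂ k 0 - f₂ (-k) 0 * f₁ k 0)) * hE
  have hb : ‖J‖ ≤ N * (C₁ * C₂ * Real.exp (2 * |k.im|) / (1 + ‖k‖) ^ 2) := by
    rw [hN, ← intervalIntegral.integral_mul_const]
    refine intervalIntegral.norm_integral_le_of_norm_le zero_le_one
      (Filter.Eventually.of_forall fun t ht => ?_) (hD.mul_const _)
    have ht' : t ∈ Icc (0:ℝ) 1 := ⟨ht.1.le, ht.2⟩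
    have a1 := H₁ k _ _ hk hs s0 s1 t ht'
    have a2 := H₂ k _ _ hk hu u0 u1 t ht'
    have a3 : Real.exp (|k.im| * t) ≤ Real.exp |k.im| :=
      Real.exp_le_exp.2 (mul_le_of_le_one_right (abs_nonneg _) ht.2)
    have e1 : ((q₂ t : ℂ) - k ^ 2 - (q₁ t - k ^ 2)) = ((q₂ t - q₁ t : ℝ) : ℂ) := by
      push_cast; ring
    rw [norm_mul, norm_mul, e1, Complex.norm_real, Real.norm_eq_abs]
    have e2 : C₁ * C₂ * Real.exp (2 * |k.im|) / (1 + ‖k‖) ^ 2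
        = (C₁ * Real.exp |k.im| / (1 + ‖k‖)) * (C₂ * Real.exp |k.im| / (1 + ‖k‖)) := by
      rw [two_mul, Real.exp_add]
      field_simp
    rw [e2]
    gcongr
    · exact a1.trans (by gcongr)
    · exact a2.trans (by gcongr)
  rw [e, norm_mul]
  have : ‖2 * Complex.I * k‖ = 2 * ‖k‖ := by simp
  rw [this]
  calc _ ≤ 2 * ‖k‖ * (N * (C₁ * C₂ * Real.exp (2 * |k.im|) / (1 + ‖k‖) ^ 2)) := by gcongr
    _ = _ := by ring

lemma differentiable_cross : Differentiable ℂ (cross f₁ f₂ 0) := by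
  have h0 : cross f₁ f₂ 0 0 = 0 := by rw [cross, neg_zero]; ring
  rw [← differentiableOn_univ]
  refine (Complex.differentiableOn_compl_singleton_and_continuousAt_iff (c := 0)
    Filter.univ_mem).1 ⟨fun z hz => (differentiableAt_cross hq₁ hq₂ hf₁ hf₂ (by simp)
      hz.2).differentiableWithinAt, ?_⟩
  obtain ⟨C, hC, H⟩ := exists_cross_bound hq₁ hq₂ hf₁ hf₂
  rw [ContinuousAt, h0]
  have hlim : Filter.Tendsto (fun k : ℂ => C * ‖k‖ * Real.exp (2 * |k.im|) / (1 + ‖k‖) ^ 2)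
      (nhds 0) (nhds 0) := by
    have : ContinuousAt (fun k : ℂ => C * ‖k‖ * Real.exp (2 * |k.im|) / (1 + ‖k‖) ^ 2) 0 := by
      refine ContinuousAt.div ?_ (by fun_prop) (by simp)
      have : Continuous fun k : ℂ => k.im := Complex.continuous_im
      fun_prop
    simpa [ContinuousAt] using this
  refine squeeze_zero_norm (fun k => ?_) hlim
  by_cases hk : k = 0
  · rw [hk, h0]; simp
  · exact H k hk

/-- Equality of the S-matrices propagates from `0` to `[0,1]`. -/
lemma cross_eq_zero (hF : ∀ k, cross f₁ f₂ 0 k = 0) {x : ℝ} (hx : x ∈ Icc (0:ℝ) 1) {k : ℂ}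
    (hk : k ≠ 0) : cross f₁ f₂ x k = 0 := by
  have h0m : (0:ℝ) ∈ Icc (0:ℝ) 1 := by simp
  obtain ⟨B₁, hB₁, G₁⟩ := exists_regular_bound hq₁
  obtain ⟨B₂, hB₂, G₂⟩ := exists_regular_bound hq₂
  obtain ⟨C₁, hC₁, H₁⟩ := exists_jost_bound hq₁
  obtain ⟨C₂, hC₂, H₂⟩ := exists_jost_bound hq₂
  obtain ⟨R₁, hR₁, L₁⟩ := exists_jost_lower_bound hq₁ hf₁
  obtain ⟨R₂, hR₂, L₂⟩ := exists_jost_lower_bound hq₂ hf₂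
  set R := max R₁ R₂ with hR
  obtain ⟨M₁, hM₁⟩ := exists_bound_on_ball hq₁ hf₁ R
  obtain ⟨M₂, hM₂⟩ := exists_bound_on_ball hq₂ hf₂ R
  have upper : ∀ k : ℂ, 0 ≤ k.im → R ≤ ‖k‖ →
      ‖cross f₁ f₂ x k‖ ≤ 4 * (B₁ * C₂ + B₂ * C₁) := by
    intro k hi hkR
    have hk : k ≠ 0 := by
      rintro rfl
      rw [norm_zero] at hkR
      linarith [le_max_left R₁ R₂]
    obtain ⟨s, s', hs, s0, s1, es, es'⟩ := isSol_regular hf₁ hk h0m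
    obtain ⟨u, u', hu, u0, u1, eu, eu'⟩ := isSol_regular hf₂ hk h0m
    have b1 := G₁ k _ _ hk hs s0 s1 x hx
    have b2 := G₂ k _ _ hk hu u0 u1 x hx
    have c1 := (H₁ k _ _ hk (hf₁ k) x hx).1
    have c2 := (H₂ k _ _ hk (hf₂ k) x hx).1
    have l1 := L₁ k hi ((le_max_left _ _).trans hkR) 0 h0m
    have l2 := L₂ k hi ((le_max_right _ _).trans hkR) 0 h0m
    rw [abs_of_nonneg hi] at b1 b2 c1 c2
    simp only [sub_self, Real.exp_zero, mul_one] at c1 c2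
    simp only [mul_zero, neg_zero, Real.exp_zero] at l1 l2
    have n1 : f₁ k 0 ≠ 0 := by rw [← norm_pos_iff]; linarith
    have n2 : f₂ k 0 ≠ 0 := by rw [← norm_pos_iff]; linarith
    have hI := Complex.I_ne_zero
    have e : cross f₁ f₂ x k
        = -(2 * Complex.I * k) * (s x * f₂ k x / f₁ k 0 - u x * f₁ k x / f₂ k 0) := by
      have h := hF k
      rw [cross] at h
      rw [es, eu, cross]
      field_simp
      linear_combination (f₁ k x * f₂ k x) * h
    have hn : ‖-(2 * Complex.I * k)‖ = 2 * ‖k‖ := by simp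
    have one : ∀ (B C : ℝ) (a b c : ℂ), 0 ≤ B → 0 ≤ C → ‖a‖ ≤ B * Real.exp (k.im * x) / (1 + ‖k‖) →
        ‖b‖ ≤ C * Real.exp (-(k.im * x)) → 1 / 2 ≤ ‖c‖ → ‖a * b / c‖ ≤ 2 * (B * C) / (1 + ‖k‖) := by
      intro B C a b c hB hC ha hb hc
      rw [norm_div, norm_mul]
      calc ‖a‖ * ‖b‖ / ‖c‖ ≤ (B * Real.exp (k.im * x) / (1 + ‖k‖)) *
            (C * Real.exp (-(k.im * x))) / (1 / 2) := by gcongr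
        _ = _ := by
            rw [Real.exp_neg]
            field_simp
    have t1 := one B₁ C₂ (s x) (f₂ k x) (f₁ k 0) hB₁ hC₂ b1 c2 l1
    have t2 := one B₂ C₁ (u x) (f₁ k x) (f₂ k 0) hB₂ hC₁ b2 c1 l2
    rw [e, norm_mul, hn]
    calc _ ≤ 2 * ‖k‖ * (2 * (B₁ * C₂) / (1 + ‖k‖) + 2 * (B₂ * C₁) / (1 + ‖k‖)) := by
          gcongr
          exact (norm_sub_le _ _).trans (add_le_add t1 t2)
      _ = 4 * (B₁ * C₂ + B₂ * C₁) * (‖k‖ / (1 + ‖k‖)) := by ring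
      _ ≤ 4 * (B₁ * C₂ + B₂ * C₁) * 1 := by
          gcongr
          rw [div_le_one (by positivity)]
          linarith
      _ = _ := mul_one _
  refine eq_zero_of_odd_of_bounded (M := max (4 * (B₁ * C₂ + B₂ * C₁)) (M₁ * M₂ + M₂ * M₁))
    (fun z hz => differentiableAt_cross hq₁ hq₂ hf₁ hf₂ hx hz) (cross_neg x) (fun z hz => ?_) hk
  by_cases hzR : ‖z‖ ≤ R
  · refine le_max_of_le_right ?_
    have hz' : -z ≠ 0 := neg_ne_zero.2 hz
    have hzR' : ‖-z‖ ≤ R := by rwa [norm_neg]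
    have hM0 : 0 ≤ M₁ := (norm_nonneg _).trans (hM₁ z hz hzR x hx)
    have hM0' : 0 ≤ M₂ := (norm_nonneg _).trans (hM₂ z hz hzR x hx)
    rw [cross]
    refine (norm_sub_le _ _).trans ?_
    rw [norm_mul, norm_mul]
    gcongr
    · exact hM₁ _ hz' hzR' x hx
    · exact hM₂ _ hz hzR x hx
    · exact hM₂ _ hz' hzR' x hx
    · exact hM₁ _ hz hzR x hx
  · refine le_max_of_le_left ?_
    push Not at hzR
    rcases le_total 0 z.im with hi | hi
    · exact upper z hi hzR.le
    · have := upper (-z) (by simpa using hi) (by rw [norm_neg]; exact hzR.le)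
      rwa [cross_neg, norm_neg] at this

/-- Potentials whose Jost solutions have proportional values on `[0,1]` agree. -/
lemma ae_eq_of_cross_eq_zero
    (hE : ∀ x ∈ Icc (0:ℝ) 1, ∀ k : ℂ, k ≠ 0 → cross f₁ f₂ x k = 0) :
    ∀ᵐ x, x ∈ Icc (0:ℝ) 1 → q₁ x = q₂ x := by
  obtain ⟨R₁, hR₁, L₁⟩ := exists_jost_lower_bound hq₁ hf₁
  obtain ⟨R₂, hR₂, L₂⟩ := exists_jost_lower_bound hq₂ hf₂
  set k : ℂ := ((R₁ + R₂ : ℝ) : ℂ) with hk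
  have hkn : ‖k‖ = R₁ + R₂ := by
    rw [hk, Complex.norm_real, Real.norm_eq_abs, abs_of_pos (by positivity)]
  have hk0 : k ≠ 0 := by
    rw [← norm_pos_iff, hkn]; positivity
  have hki : k.im = 0 := by rw [hk, Complex.ofReal_im]
  have n1 : ∀ x ∈ Icc (0:ℝ) 1, f₁ k x ≠ 0 := fun x hx => by
    have := L₁ k hki.ge (by linarith) x hx
    rw [← norm_pos_iff]
    exact lt_of_lt_of_le (by positivity) this
  have n2 : ∀ x ∈ Icc (0:ℝ) 1, f₂ k x ≠ 0 := fun x hx => by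
    have := L₂ k hki.ge (by linarith) x hx
    rw [← norm_pos_iff]
    exact lt_of_lt_of_le (by positivity) this
  have hz : ∀ x : ℝ, HasDerivAt (fun _ : ℝ => (0:ℂ)) 0 x := fun x => hasDerivAt_const _ _
  have hsq : ∀ x ∈ Ioo (0:ℝ) 1, f₁ k x * f₁ k x - f₂ k x * f₂ k x = 0 := by
    intro x hx
    have hx' := Ioo_subset_Icc_self hx
    have e := hE x hx' k hk0
    have hd := (((isSol_neg hf₁ k).1 x hx').mul ((hf₂ k).isSol.1 x hx')).sub
      (((isSol_neg hf₂ k).1 x hx').mul ((hf₁ k).isSol.1 x hx'))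
    have e' := hd.unique ((hz x).congr_of_eventuallyEq (by
      filter_upwards [Ioo_mem_nhds hx.1 hx.2] with y hy
      exact hE y (Ioo_subset_Icc_self hy) k hk0))
    have w1 := jost_wronskian hf₁ k hx'
    have w2 := jost_wronskian hf₂ k hx'
    rw [cross] at e
    have hw : 2 * Complex.I * k ≠ 0 := mul_ne_zero (mul_ne_zero two_ne_zero Complex.I_ne_zero) hk0
    refine (mul_eq_zero.1 ?_).resolve_left hw
    linear_combination (f₁ k x * f₂ k x) * e' - (f₂ k x) ^ 2 * w1 + (f₁ k x) ^ 2 * w2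
      - (f₂ k x * f₁' k x + f₁ k x * f₂' k x) * e
  have hW : ∀ x ∈ Ioo (0:ℝ) 1, f₁ k x * f₂' k x - f₁' k x * f₂ k x = 0 := by
    intro x hx
    have hx' := Ioo_subset_Icc_self hx
    have da := (hf₁ k).isSol.1 x hx'
    have dc := (hf₂ k).isSol.1 x hx'
    have e' := ((da.mul da).sub (dc.mul dc)).unique ((hz x).congr_of_eventuallyEq (by
      filter_upwards [Ioo_mem_nhds hx.1 hx.2] with y hy
      exact hsq y hy))
    refine (mul_eq_zero.1 ?_).resolve_left (n1 x hx')
    linear_combination f₂' k x * hsq x hx - f₂ k x / 2 * e'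
  have h0 : ∀ᵐ x : ℝ, x ≠ 0 := by simp [ae_iff]
  have h1 : ∀ᵐ x : ℝ, x ≠ 1 := by simp [ae_iff]
  filter_upwards [((hf₁ k).isSol.wronskian (hf₂ k).isSol).ae_hasDerivAt, h0, h1]
    with x hx hx0 hx1 hmem
  have hxo : x ∈ Ioo (0:ℝ) 1 := ⟨lt_of_le_of_ne hmem.1 hx0.symm, lt_of_le_of_ne hmem.2 hx1⟩
  have e := (hx hmem).unique ((hz x).congr_of_eventuallyEq (by
    filter_upwards [Ioo_mem_nhds hxo.1 hxo.2] with y hy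
    exact hW y hy))
  have e2 := (mul_eq_zero.1 e).resolve_right (mul_ne_zero (n1 x hmem) (n2 x hmem))
  have e3 : (q₁ x : ℂ) = q₂ x := by linear_combination -e2
  exact_mod_cast e3

end Pair

section Jensen

open Real

lemma integral_abs_sin : ∫ θ in (0:ℝ)..2 * π, |sin θ| = 4 := by
  have hi : ∀ a b : ℝ, IntervalIntegrable (fun θ => |sin θ|) volume a b := fun a b =>
    (by fun_prop : Continuous fun θ : ℝ => |sin θ|).intervalIntegrable a b
  rw [← intervalIntegral.integral_add_adjacent_intervals (hi 0 π) (hi π (2 * π))]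
  have h1 : ∫ θ in (0:ℝ)..π, |sin θ| = 2 := by
    rw [intervalIntegral.integral_congr (g := sin) fun θ hθ => ?_]
    · rw [integral_sin]; norm_num
    · rw [uIcc_of_le pi_pos.le] at hθ
      exact abs_of_nonneg (sin_nonneg_of_nonneg_of_le_pi hθ.1 hθ.2)
  have h2 : ∫ θ in π..2 * π, |sin θ| = 2 := by
    have := intervalIntegral.integral_comp_add_right (a := 0) (b := π) (fun θ => |sin θ|) π
    rw [zero_add, ← two_mul] at this
    rw [← this, ← h1]
    simp [sin_add_pi]
  rw [h1, h2]; norm_num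

/-- Upper bound of the mean of `log ‖F‖` over a circle for a function of exponential type. -/
lemma circleAverage_log_norm_le {F : ℂ → ℂ} (hF : Differentiable ℂ F) (hne : ∃ z, F z ≠ 0) {C : ℝ}
    (hC : 0 < C) (hb : ∀ z, z ≠ 0 → ‖F z‖ ≤ C * exp (2 * |z.im|) / ‖z‖) {R : ℝ} (hR : 0 < R) :
    circleAverage (fun z => log ‖F z‖) 0 R ≤ log C - log R + 4 * R / π := by
  have hFa : AnalyticOnNhd ℂ F univ := fun z _ => hF.analyticAt z
  obtain ⟨z₀, hz₀⟩ := hne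
  have hcod := hFa.preimage_zero_mem_codiscreteWithin hz₀ (mem_univ z₀) isConnected_univ
  have hae : ∀ᵐ θ ∂(volume.restrict (uIoc 0 (2 * π))), F (circleMap 0 R θ) ≠ 0 :=
    ae_restrict_le_codiscreteWithin measurableSet_uIoc
      (Filter.codiscreteWithin_mono (subset_univ _) (circleMap_preimage_codiscrete hR.ne'
        (Filter.codiscreteWithin_mono (subset_univ _) hcod)))
  have hint : CircleIntegrable (fun z => log ‖F z‖) 0 R :=
    MeromorphicOn.circleIntegrable_log_norm fun z _ => (hF.analyticAt z).meromorphicAt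
  have hcont : Continuous fun θ : ℝ => (log C - log R) + 2 * R * |sin θ| := by fun_prop
  have hle : ∫ θ in (0:ℝ)..2 * π, log ‖F (circleMap 0 R θ)‖
      ≤ ∫ θ in (0:ℝ)..2 * π, ((log C - log R) + 2 * R * |sin θ|) := by
    rw [intervalIntegral.integral_of_le two_pi_pos.le, intervalIntegral.integral_of_le
      two_pi_pos.le]
    refine integral_mono_ae hint.1 (hcont.intervalIntegrable _ _).1 ?_
    rw [uIoc_of_le two_pi_pos.le] at hae
    filter_upwards [hae] with θ hθ
    have hn : ‖circleMap 0 R θ‖ = R := by simp [abs_of_pos hR]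
    have hn0 : circleMap 0 R θ ≠ 0 := by rw [← norm_pos_iff, hn]; exact hR
    have him : |(circleMap 0 R θ).im| = R * |sin θ| := by
      rw [circleMap_zero, Complex.exp_mul_I, Complex.im_ofReal_mul]
      simp [abs_mul, abs_of_pos hR, Complex.sin_ofReal_re]
    have h1 := hb _ hn0
    rw [hn, him] at h1
    have h2 := log_le_log (norm_pos_iff.2 hθ) h1
    rw [log_div (by positivity) hR.ne', log_mul hC.ne' (exp_pos _).ne', log_exp] at h2
    linarith
  rw [intervalIntegral.integral_add (by simp) (Continuous.intervalIntegrable (by fun_prop) _ _),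
    intervalIntegral.integral_const_mul, integral_abs_sin, intervalIntegral.integral_const,
    sub_zero, smul_eq_mul] at hle
  rw [circleAverage_def, smul_eq_mul]
  calc _ ≤ (2 * π)⁻¹ * (2 * π * (log C - log R) + 2 * R * 4) := by gcongr
    _ = _ := by
      have := pi_ne_zero
      field_simp

/-- Lower bound of the mean of `log ‖F‖` over a circle in terms of zeros of `F`. -/
lemma le_circleAverage_log_norm {F : ℂ → ℂ} (hF : Differentiable ℂ F) (hne : ∃ z, F z ≠ 0)
    (h0 : F 0 = 0) {R : ℝ} (hR : 1 ≤ R) (S : Finset ℂ)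
    (hS : ∀ u ∈ S, u ≠ 0 ∧ ‖u‖ ≤ R ∧ F u = 0) :
    ∑ u ∈ S, log (R / ‖u‖) + log R + log ‖meromorphicTrailingCoeffAt F 0‖
      ≤ circleAverage (fun z => log ‖F z‖) 0 R := by
  have hR0 : 0 < R := by linarith
  have hFa : AnalyticOnNhd ℂ F univ := fun z _ => hF.analyticAt z
  have hFb : AnalyticOnNhd ℂ F (Metric.closedBall 0 |R|) := fun z _ => hF.analyticAt z
  have htop : ∀ z, analyticOrderAt F z ≠ ⊤ := by
    intro z hz
    obtain ⟨z₀, hz₀⟩ := hne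
    apply hz₀
    have := hFa.eq_of_eventuallyEq (g := fun _ => 0) (fun z _ => analyticAt_const)
      (analyticOrderAt_eq_top.1 hz)
    rw [this]
  set D := MeromorphicOn.divisor F (Metric.closedBall 0 |R|) with hD
  have hDn : ∀ z ∈ Metric.closedBall (0:ℂ) |R|, D z = (analyticOrderNatAt F z : ℤ) := by
    intro z hz
    rw [hD, MeromorphicOn.AnalyticOnNhd.divisor_apply hFb hz,
      ← Nat.cast_analyticOrderNatAt (htop z)]
    simp
  have hD0 : ∀ z, 0 ≤ D z := by
    intro z
    by_cases hz : z ∈ Metric.closedBall (0:ℂ) |R|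
    · rw [hDn z hz]; positivity
    · rw [Function.locallyFinsuppWithin.apply_eq_zero_of_notMem _ hz]
  have hD1 : ∀ z ∈ Metric.closedBall (0:ℂ) |R|, F z = 0 → 1 ≤ D z := by
    intro z hz hFz
    rw [hDn z hz]
    have : analyticOrderAt F z ≠ 0 := (hF.analyticAt z).analyticOrderAt_ne_zero.2 hFz
    rw [← Nat.cast_analyticOrderNatAt (htop z)] at this
    have h1 : analyticOrderNatAt F z ≠ 0 := by exact_mod_cast this
    exact_mod_cast Nat.one_le_iff_ne_zero.2 h1
  rw [MeromorphicOn.circleAverage_log_norm hR0.ne' hFb.meromorphicOn]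
  have hfin := D.finiteSupport (isCompact_closedBall 0 |R|)
  have hterm : ∀ u, 0 ≤ (D u : ℝ) * log (R * ‖0 - u‖⁻¹) := by
    intro u
    by_cases hu : u ∈ Metric.closedBall (0:ℂ) |R|
    · refine mul_nonneg (by exact_mod_cast hD0 u) ?_
      rw [mem_closedBall_zero_iff, abs_of_pos hR0] at hu
      by_cases hu0 : u = 0
      · simp [hu0]
      · rw [zero_sub, norm_neg, ← div_eq_mul_inv]
        exact log_nonneg ((one_le_div (norm_pos_iff.2 hu0)).2 hu)
    · rw [Function.locallyFinsuppWithin.apply_eq_zero_of_notMem _ hu]; simp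
  have hsum : ∑ u ∈ S, log (R / ‖u‖) ≤ ∑ᶠ u, (D u : ℝ) * log (R * ‖0 - u‖⁻¹) := by
    rw [finsum_eq_sum_of_support_subset (s := hfin.toFinset ∪ S) _ (by
      intro u hu
      simp only [Finset.coe_union, Finite.coe_toFinset]
      left
      intro h
      apply hu
      simp [h])]
    calc _ ≤ ∑ u ∈ S, (D u : ℝ) * log (R * ‖0 - u‖⁻¹) := by
          refine Finset.sum_le_sum fun u hu => ?_
          obtain ⟨hu0, huR, hFu⟩ := hS u hu
          have hl : 0 ≤ log (R / ‖u‖) := log_nonneg ((one_le_div (norm_pos_iff.2 hu0)).2 huR)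
          have h1 : (1:ℝ) ≤ D u := by
            exact_mod_cast hD1 u (by rwa [mem_closedBall_zero_iff, abs_of_pos hR0]) hFu
          rw [zero_sub, norm_neg, ← div_eq_mul_inv]
          exact le_mul_of_one_le_left hl h1
      _ ≤ _ := Finset.sum_le_sum_of_subset_of_nonneg Finset.subset_union_right
          fun u _ _ => hterm u
  have h1 : (1:ℝ) ≤ D 0 := by exact_mod_cast hD1 0 (by simp) h0
  have h2 : log R ≤ D 0 * log R := le_mul_of_one_le_left (log_nonneg hR) h1
  linarith

lemma log_add_one_le_sub {x : ℝ} (hx : 0 < x) :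
    log (x + 1) ≤ ((x + 1 + 1 / 2) * log (x + 1) - (x + 1)) - ((x + 1 / 2) * log x - x) := by
  have h := le_log_one_add_of_nonneg (x := 1 / x) (by positivity)
  have e : log (1 + 1 / x) = log (x + 1) - log x := by
    rw [← log_div (by positivity) hx.ne']
    congr 1; field_simp
  have e2 : 2 * (1 / x) / (1 / x + 2) = 1 / (x + 1 / 2) := by field_simp; ring
  rw [e, e2, div_le_iff₀ (by positivity)] at h
  linarith

lemma sum_log_le (N : ℕ) :
    ∑ n ∈ Finset.range N, log ((n:ℝ) + 1 + 1 / 4)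
      ≤ (((N:ℝ) + 1 / 4 + 1 / 2) * log ((N:ℝ) + 1 / 4) - ((N:ℝ) + 1 / 4))
        - ((1 / 4 + 1 / 2) * log (1 / 4) - 1 / 4) := by
  induction N with
  | zero => simp
  | succ N ih =>
    rw [Finset.sum_range_succ]
    have := log_add_one_le_sub (x := (N:ℝ) + 1 / 4) (by positivity)
    rw [show (N:ℝ) + 1 / 4 + 1 = N + 1 + 1 / 4 by ring] at this
    push_cast
    linarith

/-- An entire function of exponential type at most `2` along the imaginary axis, with decay `1/‖k‖`
and zeros close to all points `π n / 2`, vanishes. -/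
lemma eq_zero_of_zeros {F : ℂ → ℂ} (hF : Differentiable ℂ F) (h0 : F 0 = 0) {C : ℝ} (hC : 0 < C)
    (hb : ∀ z, z ≠ 0 → ‖F z‖ ≤ C * exp (2 * |z.im|) / ‖z‖) {r : ℕ → ℝ}
    (hrpos : ∀ n, 1 ≤ n → 0 < r n) (hr : ∀ n : ℕ, 1 ≤ n → |r n - π * n / 2| < π / 8)
    (hz : ∀ n, 1 ≤ n → F (r n) = 0) (hz' : ∀ n, 1 ≤ n → F (-(r n : ℂ)) = 0) (z : ℂ) :
    F z = 0 := by
  by_contra hne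
  have hne' : ∃ z, F z ≠ 0 := ⟨z, hne⟩
  have hlt : ∀ m n : ℕ, 1 ≤ m → m < n → r m < r n := by
    intro m n hm hmn
    have h1 := (abs_lt.1 (hr m hm)).2
    have h2 := (abs_lt.1 (hr n (hm.trans hmn.le))).1
    have h3 : (m:ℝ) + 1 ≤ n := by exact_mod_cast hmn
    nlinarith [pi_pos]
  have hinj : ∀ m n : ℕ, r (m + 1) = r (n + 1) → m = n := by
    intro m n h
    rcases lt_trichotomy m n with h1 | h1 | h1
    · exact absurd h (hlt _ _ (by omega) (by omega)).ne
    · exact h1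
    · exact absurd h (hlt _ _ (by omega) (by omega)).ne'
  set t := log ‖meromorphicTrailingCoeffAt F 0‖ with ht
  set g : ℝ := (1 / 4 + 1 / 2) * log (1 / 4) - 1 / 4 with hg
  have key : ∀ N : ℕ, 1 ≤ N →
      log ((N:ℝ) + 1 / 4) / 2 ≤ log C - t - 2 * g - 2 * log (π / 2) := by
    intro N hN
    set x : ℝ := (N:ℝ) + 1 / 4 with hx
    have hN' : (1:ℝ) ≤ N := by exact_mod_cast hN
    have hx0 : 0 < x := by positivity
    set R : ℝ := π / 2 * x with hR
    have hR1 : 1 ≤ R := by nlinarith [pi_gt_three]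
    have hR0 : 0 < R := by linarith
    have hrR : ∀ n ∈ Finset.range N, r (n + 1) < π / 2 * ((n:ℝ) + 1 + 1 / 4) ∧
        r (n + 1) ≤ R := by
      intro n hn
      have h1 := (abs_lt.1 (hr (n + 1) (by omega))).2
      have h2 : (n:ℝ) + 1 ≤ N := by exact_mod_cast Finset.mem_range.1 hn
      push_cast at h1
      constructor <;> nlinarith [pi_pos]
    have hpos : ∀ n : ℕ, 0 < r (n + 1) := fun n => hrpos _ (by omega)
    set S₁ := (Finset.range N).image fun n => ((r (n + 1) : ℝ) : ℂ) with hS₁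
    set S₂ := (Finset.range N).image fun n => -((r (n + 1) : ℝ) : ℂ) with hS₂
    have hdisj : Disjoint S₁ S₂ := by
      rw [Finset.disjoint_left]
      intro u hu hu'
      obtain ⟨m, -, rfl⟩ := Finset.mem_image.1 hu
      obtain ⟨n, -, h⟩ := Finset.mem_image.1 hu'
      have h1 := congrArg Complex.re h
      simp only [Complex.neg_re, Complex.ofReal_re] at h1
      linarith [hpos m, hpos n]
    have hnorm : ∀ n, ‖((r (n + 1) : ℝ) : ℂ)‖ = r (n + 1) := fun n => by
      rw [Complex.norm_real, norm_eq_abs, abs_of_pos (hpos n)]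
    have hlow := le_circleAverage_log_norm hF hne' h0 hR1 (S₁ ∪ S₂) (by
      intro u hu
      rcases Finset.mem_union.1 hu with hu | hu
      · obtain ⟨n, hn, rfl⟩ := Finset.mem_image.1 hu
        exact ⟨by exact_mod_cast (hpos n).ne', by rw [hnorm]; exact (hrR n hn).2,
          hz _ (by omega)⟩
      · obtain ⟨n, hn, rfl⟩ := Finset.mem_image.1 hu
        exact ⟨neg_ne_zero.2 (by exact_mod_cast (hpos n).ne'),
          by rw [norm_neg, hnorm]; exact (hrR n hn).2, hz' _ (by omega)⟩)
    have hup := circleAverage_log_norm_le hF hne' hC hb hR0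
    rw [Finset.sum_union hdisj, Finset.sum_image (fun m _ n _ h => hinj m n (by exact_mod_cast h)),
      Finset.sum_image (fun m _ n _ h => hinj m n (by exact_mod_cast neg_injective h))] at hlow
    simp only [norm_neg, hnorm] at hlow
    have hsum : N * log x - ∑ n ∈ Finset.range N, log ((n:ℝ) + 1 + 1 / 4)
        ≤ ∑ n ∈ Finset.range N, log (R / r (n + 1)) := by
      have : (N:ℝ) * log x = ∑ n ∈ Finset.range N, log x := by simp
      rw [this, ← Finset.sum_sub_distrib]
      refine Finset.sum_le_sum fun n hn => ?_
      rw [← log_div hx0.ne' (by positivity)]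
      refine log_le_log (by positivity) ?_
      rw [div_le_div_iff₀ (by positivity) (hpos n), hR]
      have := mul_le_mul_of_nonneg_left (hrR n hn).1.le hx0.le
      linarith
    have hs := sum_log_le N
    rw [← hx, ← hg] at hs
    have hlogR : log R = log (π / 2) + log x := by
      rw [hR, log_mul (by positivity) hx0.ne']
    have h4 : 4 * R / π = 2 * x := by
      rw [hR]
      have := pi_ne_zero
      field_simp
      ring
    rw [h4] at hup
    have hNx : (N:ℝ) = x - 1 / 4 := by rw [hx]; ring
    rw [hNx] at hsum
    linarith
  set K := log C - t - 2 * g - 2 * log (π / 2)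
  obtain ⟨N, hN⟩ := exists_nat_gt (exp (2 * K))
  have h1 := key (N + 1) (by omega)
  have h2 : 2 * K < log (((N + 1 : ℕ) : ℝ) + 1 / 4) := by
    rw [lt_log_iff_exp_lt (by positivity)]
    push_cast
    linarith
  linarith

end Jensen

/-- If the S-matrices of two compactly supported integrable potentials
agree at every point of a sequence `r n` with `|r n - πn/2| < π/8`, the potentials coincide
almost everywhere. -/
theorem statement0
    (q₁ q₂ : ℝ → ℝ)
    (hq₁int : Integrable q₁) (hq₂int : Integrable q₂)
    (hq₁supp : ∀ x : ℝ, x ∉ Icc (0:ℝ) 1 → q₁ x = 0)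
    (hq₂supp : ∀ x : ℝ, x ∉ Icc (0:ℝ) 1 → q₂ x = 0)
    (f₁ f₁' f₂ f₂' : ℂ → ℝ → ℂ)
    (hf₁ : ∀ k : ℂ, IsJost (fun x => (q₁ x : ℂ)) k (f₁ k) (f₁' k))
    (hf₂ : ∀ k : ℂ, IsJost (fun x => (q₂ x : ℂ)) k (f₂ k) (f₂' k))
    (ψ₁ ψ₂ : ℂ → ℂ)
    (hψ₁ : ∀ k, ψ₁ k = f₁ k 0) (hψ₂ : ∀ k, ψ₂ k = f₂ k 0)
    (r : ℕ → ℝ)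
    (hrpos : ∀ n : ℕ, 1 ≤ n → 0 < r n)
    (hr : ∀ n : ℕ, 1 ≤ n → |r n - Real.pi * n / 2| < Real.pi / 8)
    (hS : ∀ n : ℕ, 1 ≤ n →
      ψ₁ (-(r n : ℂ)) * ψ₂ ((r n : ℂ)) = ψ₂ (-(r n : ℂ)) * ψ₁ ((r n : ℂ))) :
    q₁ =ᵐ[volume] q₂ := by
  have hI₁ : IntervalIntegrable q₁ volume 0 1 := hq₁int.intervalIntegrable
  have hI₂ : IntervalIntegrable q₂ volume 0 1 := hq₂int.intervalIntegrable
  have hzero : ∀ n, 1 ≤ n → cross f₁ f₂ 0 (r n) = 0 := fun n hn => by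
    have h := hS n hn
    rw [hψ₁, hψ₁, hψ₂, hψ₂] at h
    rw [cross, h, sub_self]
  have h0 : cross f₁ f₂ 0 0 = 0 := by rw [cross, neg_zero]; ring
  obtain ⟨C, hC, hb⟩ := exists_cross_bound hI₁ hI₂ hf₁ hf₂
  have hF := eq_zero_of_zeros (C := C + 1) (differentiable_cross hI₁ hI₂ hf₁ hf₂) h0 (by positivity)
    (fun z hz => (hb z hz).trans ?_) hrpos hr hzero
    (fun n hn => by rw [cross_neg, hzero n hn, neg_zero])
  · have hE : ∀ x ∈ Icc (0:ℝ) 1, ∀ k : ℂ, k ≠ 0 → cross f₁ f₂ x k = 0 :=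
      fun x hx k hk => cross_eq_zero hI₁ hI₂ hf₁ hf₂ hF hx hk
    filter_upwards [ae_eq_of_cross_eq_zero hI₁ hI₂ hf₁ hf₂ hE] with x hx
    by_cases hm : x ∈ Icc (0:ℝ) 1
    · exact hx hm
    · rw [hq₁supp x hm, hq₂supp x hm]
  · have hz' : 0 < ‖z‖ := norm_pos_iff.2 hz
    rw [div_le_div_iff₀ (by positivity) hz']
    have h1 : C * (‖z‖ * ‖z‖) ≤ (C + 1) * (1 + ‖z‖) ^ 2 := by nlinarith
    calc _ = C * (‖z‖ * ‖z‖) * Real.exp (2 * |z.im|) := by ring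
      _ ≤ (C + 1) * (1 + ‖z‖) ^ 2 * Real.exp (2 * |z.im|) := by gcongr
      _ = _ := by ring
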